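/- For every natural number N, (1/(2π)) ∫_{-π}^{π} |sin x|^{-1/3} e^{2 i N x} dx = 2^{1/3} (Γ(2/3)/Γ(5/6)²) · (-1)^N Γ(5/6)² / (Γ(5/6 - N) Γ(5/6 + N)), i.e. this Fourier coefficient equals 2^{1/3} Γ(2/3) (-1)^N / (Γ(5/6 - N) Γ(5/6 + N)). -/

import Mathlib

open MeasureTheory Real

/-- The real Beta integral at `(1/3, 1/3)`. -/
lemma aux_beta : ∫ u in (0:ℝ)..1, u ^ (-(2/3 : ℝ)) * (1 - u) ^ (-(2/3 : ℝ))
    = Real.Gamma (1/3) ^ 2 / Real.Gamma (2/3) := by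
  have h := Complex.betaIntegral_eq_Gamma_mul_div ((1/3 : ℝ) : ℂ) ((1/3 : ℝ) : ℂ)
    (by simp) (by simp)
  rw [← Complex.ofReal_add, Complex.Gamma_ofReal, Complex.Gamma_ofReal] at h
  rw [← Complex.ofReal_inj, ← intervalIntegral.integral_ofReal]
  norm_num at h ⊢
  rw [pow_two, ← h, Complex.betaIntegral]
  apply intervalIntegral.integral_congr
  intro u hu
  rw [Set.uIcc_of_le zero_le_one] at hu
  simp only
  rw [Complex.ofReal_cpow hu.1, Complex.ofReal_cpow (by linarith [hu.2])]
  push_cast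
  norm_num

lemma aux_point {x : ℝ} (hx : x ∈ Set.Ioo 0 π) :
    (Real.sin x / 2) • (((1 - Real.cos x) / 2) ^ (-(2/3 : ℝ)) *
      (1 - (1 - Real.cos x) / 2) ^ (-(2/3 : ℝ)))
    = 2 ^ ((1:ℝ)/3) * |Real.sin x| ^ (-(1/3 : ℝ)) := by
  have hs : 0 < Real.sin x := Real.sin_pos_of_pos_of_lt_pi hx.1 hx.2
  have h1 : 0 ≤ (1 - Real.cos x) / 2 := by linarith [Real.cos_le_one x]
  have h2 : 0 ≤ 1 - (1 - Real.cos x) / 2 := by linarith [Real.neg_one_le_cos x]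
  rw [← Real.mul_rpow h1 h2, abs_of_pos hs]
  have h3 : (1 - Real.cos x) / 2 * (1 - (1 - Real.cos x) / 2) = (Real.sin x / 2) ^ (2:ℝ) := by
    rw [Real.rpow_two]
    nlinarith [Real.sin_sq_add_cos_sq x]
  have hp : 0 < Real.sin x / 2 := by positivity
  rw [h3, ← Real.rpow_mul hp.le, smul_eq_mul]
  nth_rewrite 1 [← Real.rpow_one (Real.sin x / 2)]
  rw [← Real.rpow_add hp, show (1:ℝ) + 2 * -(2/3) = -(1/3) by norm_num,
    Real.div_rpow hs.le zero_le_two, Real.rpow_neg zero_le_two]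
  simp [mul_comm]

lemma aux_zero : ∫ x in (0:ℝ)..π, |Real.sin x| ^ (-(1/3 : ℝ))
    = Real.Gamma (1/3) ^ 2 / Real.Gamma (2/3) / 2 ^ ((1:ℝ)/3) := by
  have h := integral_Icc_deriv_smul_of_deriv_nonneg (a := 0) (b := π)
    (f := fun x => (1 - Real.cos x) / 2) (f' := fun x => Real.sin x / 2)
    (g := fun u : ℝ => u ^ (-(2/3 : ℝ)) * (1 - u) ^ (-(2/3 : ℝ)))
    (by fun_prop)
    (fun x _ => by
      have := ((Real.hasDerivAt_cos x).const_sub 1).div_const 2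
      simpa using this)
    (fun x hx => by
      have := Real.sin_pos_of_pos_of_lt_pi hx.1 hx.2
      positivity) Real.pi_pos.le
  have e1 : (1 - Real.cos 0) / 2 = 0 := by simp
  have e2 : (1 - Real.cos π) / 2 = 1 := by norm_num
  simp only [e1, e2] at h
  rw [integral_Icc_eq_integral_Ioo,
    setIntegral_congr_fun measurableSet_Ioo (fun x hx => aux_point hx),
    ← integral_Ioc_eq_integral_Ioo, integral_Icc_eq_integral_Ioc,
    ← intervalIntegral.integral_of_le Real.pi_pos.le,
    ← intervalIntegral.integral_of_le zero_le_one, aux_beta,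
    intervalIntegral.integral_const_mul] at h
  rw [← h]
  field_simp

lemma aux_int : IntervalIntegrable (fun x => |Real.sin x| ^ (-(1/3 : ℝ))) volume 0 π := by
  by_contra hc
  have h0 := intervalIntegral.integral_undef hc
  rw [aux_zero] at h0
  have h1 : 0 < Real.Gamma (1/3) := Real.Gamma_pos_of_pos (by norm_num)
  have h2 : 0 < Real.Gamma (2/3) := Real.Gamma_pos_of_pos (by norm_num)
  have : 0 < Real.Gamma (1/3) ^ 2 / Real.Gamma (2/3) / 2 ^ ((1:ℝ)/3) := by positivity
  linarith

/-- Half-period cosine integrals. -/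
noncomputable def auxI (N : ℕ) : ℝ :=
  ∫ x in (0:ℝ)..π, |Real.sin x| ^ (-(1/3 : ℝ)) * Real.cos (2 * N * x)

lemma aux_int_cos (N : ℕ) : IntervalIntegrable
    (fun x => |Real.sin x| ^ (-(1/3 : ℝ)) * Real.cos (2 * N * x)) volume 0 π :=
  aux_int.mul_continuousOn (by fun_prop)

lemma aux_rec (N : ℕ) : ((N:ℝ) + 5/6) * auxI (N+1) = (N + 1/6) * auxI N := by
  have hi := ((aux_int_cos (N+1)).const_mul ((N:ℝ) + 5/6)).sub
    ((aux_int_cos N).const_mul ((N:ℝ) + 1/6))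
  have h := intervalIntegral.integral_eq_sub_of_hasDerivAt_of_le (a := 0) (b := π)
    (f := fun x => Real.sin x ^ (2/3 : ℝ) * Real.cos ((2 * N + 1) * x))
    Real.pi_pos.le
    (by
      apply ContinuousOn.mul
      · exact ContinuousOn.rpow_const (by fun_prop) (fun x _ => Or.inr (by norm_num))
      · fun_prop)
    (fun x hx => ?_) hi
  · have hi2 := intervalIntegral.integral_sub ((aux_int_cos (N+1)).const_mul ((N:ℝ) + 5/6))
      ((aux_int_cos N).const_mul ((N:ℝ) + 1/6))
    rw [intervalIntegral.integral_const_mul, intervalIntegral.integral_const_mul] at hi2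
    have h' := hi2.symm.trans h
    rw [Real.sin_pi, Real.sin_zero, Real.zero_rpow (by norm_num)] at h'
    unfold auxI
    linarith
  · have hs : 0 < Real.sin x := Real.sin_pos_of_pos_of_lt_pi hx.1 hx.2
    have d1 := (Real.hasDerivAt_sin x).rpow_const (p := 2/3) (Or.inl hs.ne')
    have d2 : HasDerivAt (fun y : ℝ => Real.cos ((2 * N + 1) * y))
        (-Real.sin ((2 * N + 1) * x) * (2 * N + 1)) x := by
      have := ((hasDerivAt_id x).const_mul (2 * (N:ℝ) + 1)).cos
      simpa using this
    convert! d1.mul d2 using 1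
    have hp : Real.sin x ^ (2/3 : ℝ) = Real.sin x ^ (-(1/3) : ℝ) * Real.sin x := by
      rw [← Real.rpow_add_one hs.ne']; norm_num
    rw [hp, abs_of_pos hs, show (2/3 - 1 : ℝ) = -(1/3) by norm_num]
    have c1 : Real.cos (2 * ((N + 1 : ℕ):ℝ) * x) =
        Real.cos ((2 * N + 1) * x) * Real.cos x - Real.sin ((2 * N + 1) * x) * Real.sin x := by
      rw [← Real.cos_add]; push_cast; ring_nf
    have c2 : Real.cos (2 * (N:ℝ) * x) =
        Real.cos ((2 * N + 1) * x) * Real.cos x + Real.sin ((2 * N + 1) * x) * Real.sin x := by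
      rw [← Real.cos_sub]; ring_nf
    rw [c1, c2]
    ring

lemma aux_gne (N : ℕ) : Real.Gamma (5/6 - N) ≠ 0 := by
  apply Real.Gamma_ne_zero
  intro m h
  have h2 : (5:ℝ) + 6 * m = 6 * N := by linarith
  norm_cast at h2
  omega

lemma aux_closed (N : ℕ) : auxI N = π * ((2 : ℝ) ^ ((1 : ℝ)/3) * Real.Gamma (2/3) * (-1) ^ N /
        (Real.Gamma (5/6 - N) * Real.Gamma (5/6 + N))) := by
  induction N with
  | zero =>
    have h : auxI 0 = _ := Eq.trans (by simp [auxI]) aux_zero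
    rw [h]
    have hd := Real.Gamma_mul_Gamma_add_half (1/3)
    norm_num at hd
    have h1 : 0 < Real.Gamma (5/6) := Real.Gamma_pos_of_pos (by norm_num)
    have h2 : 0 < Real.Gamma (2/3) := Real.Gamma_pos_of_pos (by norm_num)
    have hsq := congrArg (fun t => t ^ 2) hd
    simp only [mul_pow, Real.sq_sqrt Real.pi_pos.le] at hsq
    simp only [Nat.cast_zero, sub_zero, add_zero, pow_zero, mul_one]
    field_simp
    norm_num at hsq ⊢
    linarith
  | succ n ih =>
    have hr := aux_rec n
    rw [ih] at hr
    have g1 : Real.Gamma (5/6 - n) = (-1/6 - n) * Real.Gamma (5/6 - (n + 1 : ℕ)) := by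
      have hne : (-1/6 - n : ℝ) ≠ 0 := by
        have : (0:ℝ) ≤ n := n.cast_nonneg
        linarith
      have := Real.Gamma_add_one hne
      rw [show (5/6 - n : ℝ) = (-1/6 - n) + 1 by ring, this]
      push_cast; ring_nf
    have g2 : Real.Gamma (5/6 + (n + 1 : ℕ)) = (5/6 + n) * Real.Gamma (5/6 + n) := by
      rw [← Real.Gamma_add_one (by positivity)]
      push_cast; ring_nf
    have n1 := aux_gne (n+1)
    have n2 : Real.Gamma (5/6 + n) ≠ 0 := (Real.Gamma_pos_of_pos (by positivity)).ne'
    have n3 : (n + 5/6 : ℝ) ≠ 0 := by positivity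
    have n4 : (-1/6 - n : ℝ) ≠ 0 := by
      have : (0:ℝ) ≤ n := n.cast_nonneg
      linarith
    have n5 : (5/6 + n : ℝ) ≠ 0 := by positivity
    apply mul_left_cancel₀ n3
    rw [hr, g1, g2, pow_succ]
    generalize Real.Gamma (5/6 - (n + 1 : ℕ)) = A at *
    generalize Real.Gamma (5/6 + n) = B at *
    generalize (2:ℝ) ^ ((1:ℝ)/3) * Real.Gamma (2/3) = C at *
    rw [← mul_div_assoc, ← mul_div_assoc, ← mul_div_assoc, ← mul_div_assoc,
      div_eq_div_iff (by positivity) (by positivity)]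
    ring

/-- The even-frequency Fourier coefficients of `|sin x|^{-1/3}`:
`(1/(2π)) ∫_{-π}^{π} |sin x|^{-1/3} e^{2iNx} dx
  = 2^{1/3} Γ(2/3) (-1)^N / (Γ(5/6 - N) Γ(5/6 + N))`. -/
theorem fourier_coeff_abs_sin_rpow_even (N : ℕ) :
    (1 / (2 * (π : ℂ))) *
      ∫ x in (-π)..π, ((|Real.sin x| ^ (-(1/3 : ℝ)) : ℝ) : ℂ) *
        Complex.exp (2 * Complex.I * N * x)
    = (((2 : ℝ) ^ ((1 : ℝ)/3) * Real.Gamma (2/3) * (-1) ^ N /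
        (Real.Gamma (5/6 - N) * Real.Gamma (5/6 + N)) : ℝ) : ℂ) := by
  have hint : IntervalIntegrable (fun x : ℝ => ((|Real.sin x| ^ (-(1/3 : ℝ)) : ℝ) : ℂ))
      volume 0 π :=
    ⟨aux_int.1.ofReal, aux_int.2.ofReal⟩
  have hp : IntervalIntegrable (fun x : ℝ => ((|Real.sin x| ^ (-(1/3 : ℝ)) : ℝ) : ℂ) *
        Complex.exp (2 * Complex.I * N * x)) volume 0 π :=
    hint.mul_continuousOn (by fun_prop)
  have hm : IntervalIntegrable (fun x : ℝ => ((|Real.sin x| ^ (-(1/3 : ℝ)) : ℝ) : ℂ) *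
        Complex.exp (2 * Complex.I * N * (-x : ℝ))) volume 0 π :=
    hint.mul_continuousOn (by fun_prop)
  have hm' : IntervalIntegrable (fun x : ℝ => ((|Real.sin x| ^ (-(1/3 : ℝ)) : ℝ) : ℂ) *
        Complex.exp (2 * Complex.I * N * x)) volume (-π) 0 := by
    rw [IntervalIntegrable.iff_comp_neg]
    simp only [Real.sin_neg, abs_neg, neg_neg, neg_zero]
    exact hm.symm
  have hneg : ∫ x in (-π)..0, ((|Real.sin x| ^ (-(1/3 : ℝ)) : ℝ) : ℂ) *
        Complex.exp (2 * Complex.I * N * x) =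
      ∫ x in (0:ℝ)..π, ((|Real.sin x| ^ (-(1/3 : ℝ)) : ℝ) : ℂ) *
        Complex.exp (2 * Complex.I * N * (-x : ℝ)) := by
    have := intervalIntegral.integral_comp_neg (a := 0) (b := π)
      (fun x : ℝ => ((|Real.sin x| ^ (-(1/3 : ℝ)) : ℝ) : ℂ) *
        Complex.exp (2 * Complex.I * N * x))
    rw [neg_zero] at this
    rw [← this]
    simp only [Real.sin_neg, abs_neg]
  rw [← intervalIntegral.integral_add_adjacent_intervals hm' hp, hneg,
    ← intervalIntegral.integral_add hm hp]
  have hfun : ∀ x : ℝ, ((|Real.sin x| ^ (-(1/3 : ℝ)) : ℝ) : ℂ) *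
        Complex.exp (2 * Complex.I * N * (-x : ℝ)) + ((|Real.sin x| ^ (-(1/3 : ℝ)) : ℝ) : ℂ) *
        Complex.exp (2 * Complex.I * N * x) =
      ((2 * (|Real.sin x| ^ (-(1/3 : ℝ)) * Real.cos (2 * N * x)) : ℝ) : ℂ) := by
    intro x
    rw [Complex.ofReal_mul, Complex.ofReal_mul, Complex.ofReal_cos, Complex.cos]
    push_cast
    rw [show (2 * (N:ℂ) * x * Complex.I) = 2 * Complex.I * N * x by ring,
      show (-(2 * (N:ℂ) * x) * Complex.I) = 2 * Complex.I * N * -x by ring]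
    ring
  simp only [hfun]
  rw [intervalIntegral.integral_ofReal, intervalIntegral.integral_const_mul]
  have hc := aux_closed N
  rw [auxI] at hc
  rw [hc]
  have hpi : (π : ℂ) ≠ 0 := by exact_mod_cast Real.pi_ne_zero
  rw [Complex.ofReal_mul, Complex.ofReal_mul]
  generalize ((((2 : ℝ) ^ ((1 : ℝ)/3) * Real.Gamma (2/3) * (-1) ^ N /
        (Real.Gamma (5/6 - N) * Real.Gamma (5/6 + N)) : ℝ)) : ℂ) = Z
  push_cast
  field_simp
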